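/- Fix reals α > 2 and C with 0 < C ≤ 1/ζ(α), where ζ is the Riemann zeta function. For all sufficiently large integers n, every simple graph H on i₁(n) vertices is an induced subgraph of some n-vertex α-proper power-law graph (with constant C). -/

import Mathlib

/-- The degree of a vertex `v` in a simple graph on `Fin n`. -/
noncomputable def deg {n : ℕ} (G : SimpleGraph (Fin n)) (v : Fin n) : ℕ :=
  (G.neighborSet v).ncard

/-- The number of vertices of `G` of degree exactly `k`. -/
noncomputable def Vcard {n : ℕ} (G : SimpleGraph (Fin n)) (k : ℕ) : ℕ :=
  {v : Fin n | deg G v = k}.ncard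

/-- `i₁(n)`: the smallest positive integer `i` with `⌊C·n / i^α⌋ ≤ 1`. -/
noncomputable def i1 (α C : ℝ) (n : ℕ) : ℕ :=
  sInf {i : ℕ | 0 < i ∧ ⌊C * (n : ℝ) / (i : ℝ) ^ α⌋ ≤ 1}

/-- `G` is an `α`-proper power-law graph with constant `C`. -/
def IsProperPowerLaw (α C : ℝ) {n : ℕ} (G : SimpleGraph (Fin n)) : Prop :=
  (⌊C * (n : ℝ)⌋ - (i1 α C n : ℤ) - 1 ≤ (Vcard G 1 : ℤ) ∧ (Vcard G 1 : ℤ) ≤ ⌈C * (n : ℝ)⌉) ∧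
  (⌊C * (n : ℝ) / (2 : ℝ) ^ α⌋ ≤ (Vcard G 2 : ℤ) ∧
    (Vcard G 2 : ℤ) ≤ ⌈C * (n : ℝ) / (2 : ℝ) ^ α⌉ + 1) ∧
  (∀ i : ℕ, 3 ≤ i → i ≤ n →
    (Vcard G i : ℤ) = ⌊C * (n : ℝ) / (i : ℝ) ^ α⌋ ∨
    (Vcard G i : ℤ) = ⌈C * (n : ℝ) / (i : ℝ) ^ α⌉) ∧
  (∀ i : ℕ, 2 ≤ i → i ≤ n - 1 → Vcard G (i + 1) ≤ Vcard G i)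

/-- The Riemann zeta function on reals: `ζ(s) = ∑_{k ≥ 1} k^(−s)`. -/
noncomputable def zetaR (s : ℝ) : ℝ := ∑' k : ℕ, ((k : ℝ) + 1) ^ (-s)


/-- Degree with a fixed decidability instance. -/
noncomputable def dg {V : Type*} [Fintype V] (G : SimpleGraph V) (w : V) : ℕ :=
  (G.neighborSet w).ncard

open Classical in
lemma dg_eq {V : Type*} [Fintype V] (G : SimpleGraph V) (w : V) : G.degree w = dg G w := by
  rw [← SimpleGraph.card_neighborFinset_eq_degree, dg, Set.ncard_eq_toFinset_card']
  rfl

open Classical in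
lemma deg_sup_edge {V : Type*} [Fintype V] (G : SimpleGraph V) (a b : V) (hab : a ≠ b)
    (h : ¬ G.Adj a b) (w : V) :
    dg (G ⊔ SimpleGraph.edge a b) w =
      dg G w + (if w = a then 1 else 0) + (if w = b then 1 else 0) := by
  unfold dg
  have h' : ¬ G.Adj b a := fun h2 => h h2.symm
  by_cases hwa : w = a
  · subst hwa
    have : (G ⊔ SimpleGraph.edge w b).neighborSet w =
        insert b (G.neighborSet w) := by
      ext z
      simp [SimpleGraph.edge_adj]
      grind
    rw [this, Set.ncard_insert_of_notMem (by simpa using h)]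
    simp [hab]
  · by_cases hwb : w = b
    · subst hwb
      have : (G ⊔ SimpleGraph.edge a w).neighborSet w =
          insert a (G.neighborSet w) := by
        ext z
        simp [SimpleGraph.edge_adj]
        grind
      rw [this, Set.ncard_insert_of_notMem (by simpa using h')]
      simp [hwa]
    · have : (G ⊔ SimpleGraph.edge a b).neighborSet w = G.neighborSet w := by
        ext z
        simp [hwa, hwb, SimpleGraph.edge_adj]
      rw [this]
      simp [hwa, hwb]

open Classical in
lemma realize {V : Type*} [Fintype V] (S : Finset V) (H : SimpleGraph V) (t : V → ℕ) (K : ℕ)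
    (hHS : ∀ x y, H.Adj x y → x ∈ S ∧ y ∈ S) (hHt : ∀ x, dg H x ≤ t x)
    (hK : ∀ x, t x ≤ K) (heven : Even (∑ x, t x))
    (hA : (S.card + 2 * K + 2) * (K + 1) + 2 ≤
      (Finset.univ.filter (fun x => x ∉ S ∧ 1 ≤ t x)).card) :
    ∃ G : SimpleGraph V, (∀ x, dg G x = t x) ∧
      ∀ x ∈ S, ∀ y ∈ S, (G.Adj x y ↔ H.Adj x y) := by
  let P : SimpleGraph V → Prop := fun G => (∀ x, dg G x ≤ t x) ∧
      ∀ x ∈ S, ∀ y ∈ S, (G.Adj x y ↔ H.Adj x y)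
  have hPH : P H := ⟨hHt, fun _ _ _ _ => Iff.rfl⟩
  obtain ⟨G, hG, hmax⟩ := Finset.exists_max_image (Finset.univ.filter P)
    (fun G => ∑ x, dg G x) ⟨H, by simpa using hPH⟩
  simp only [Finset.mem_filter, Finset.mem_univ, true_and] at hG hmax
  have hmax' : ∀ G', P G' → (∀ c : ℕ, ∑ x, dg G' x ≠ ∑ x, dg G x + 1 + c) := by
    intro G' h1 c h2
    have := hmax G' h1
    omega
  clear hmax
  obtain ⟨hd, hGS⟩ := hG
  refine ⟨G, ?_, hGS⟩
  by_contra hne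
  push Not at hne
  obtain ⟨u, hu⟩ := hne
  have hu' : dg G u < t u := lt_of_le_of_ne (hd u) hu
  -- second deficient vertex
  have hv : ∃ v, dg G v < t v ∧ (u = v → dg G u + 2 ≤ t u) := by
    by_cases h2 : dg G u + 2 ≤ t u
    · exact ⟨u, hu', fun _ => h2⟩
    by_contra hcon
    push Not at hcon
    have hall : ∀ v ∈ Finset.univ.erase u, t v = dg G v := by
      intro v hv
      by_contra hvne
      have := hcon v (lt_of_le_of_ne (hd v) (Ne.symm hvne))
      exact (Finset.ne_of_mem_erase hv) this.1.symm
    have e0 : ∑ x ∈ Finset.univ.erase u, t x = ∑ x ∈ Finset.univ.erase u, dg G x :=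
      Finset.sum_congr rfl hall
    have e1 := Finset.add_sum_erase Finset.univ t (Finset.mem_univ u)
    have e2 : dg G u + ∑ x ∈ Finset.univ.erase u, dg G x = ∑ x, dg G x := Finset.add_sum_erase Finset.univ (fun x => dg G x) (Finset.mem_univ u)
    rw [e0] at e1
    have e3 := G.sum_degrees_eq_twice_card_edges
    simp only [dg_eq] at e3
    obtain ⟨r, hr⟩ := heven
    omega
  obtain ⟨v, hv', huv⟩ := hv
  let B : Finset V := S ∪ (insert u (G.neighborFinset u) ∪ insert v (G.neighborFinset v))
  have hB : B.card ≤ S.card + 2 * K + 2 := by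
    have h1 := Finset.card_union_le S (insert u (G.neighborFinset u) ∪ insert v (G.neighborFinset v))
    have h2 := Finset.card_union_le (insert u (G.neighborFinset u)) (insert v (G.neighborFinset v))
    have h3 := Finset.card_insert_le u (G.neighborFinset u)
    have h4 := Finset.card_insert_le v (G.neighborFinset v)
    rw [G.card_neighborFinset_eq_degree, dg_eq] at h3 h4
    have h5 := hK u
    have h6 := hK v
    simp only [B]
    omega
  have hBmem : ∀ x, x ∉ B → x ∉ S ∧ x ≠ u ∧ ¬ G.Adj u x ∧ x ≠ v ∧ ¬ G.Adj v x := by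
    intro x hx
    simp only [B, Finset.mem_union, Finset.mem_insert, SimpleGraph.mem_neighborFinset] at hx
    tauto
  by_cases hxy : ∃ x y, x ∉ B ∧ y ∉ B ∧ G.Adj x y
  · obtain ⟨x, y, hx, hy, hadj⟩ := hxy
    obtain ⟨hxS, hxu, hux, hxv, hvx⟩ := hBmem x hx
    obtain ⟨hyS, hyu, huy, hyv, hvy⟩ := hBmem y hy
    have hxyne : x ≠ y := hadj.ne
    let G0 := G \ SimpleGraph.edge x y
    have hG0adj : ∀ a b, G0.Adj a b ↔ G.Adj a b ∧ ¬ ((a = x ∧ b = y) ∨ (a = y ∧ b = x)) := by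
      intro a b
      simp only [G0, SimpleGraph.sdiff_adj, SimpleGraph.edge_adj]
      grind
    have hG0 : G0 ⊔ SimpleGraph.edge x y = G := by
      ext a b
      simp only [SimpleGraph.sup_adj, hG0adj, SimpleGraph.edge_adj]
      grind [SimpleGraph.adj_comm]
    have d0 : ∀ w, dg G w = dg G0 w + (if w = x then 1 else 0) + (if w = y then 1 else 0) := by
      intro w
      have := deg_sup_edge G0 x y hxyne (by rw [hG0adj]; tauto) w
      rw [hG0] at this
      exact this
    let G1 := G0 ⊔ SimpleGraph.edge u x
    have d1 : ∀ w, dg G1 w = dg G0 w + (if w = u then 1 else 0) + (if w = x then 1 else 0) :=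
      deg_sup_edge G0 u x (Ne.symm hxu) (by rw [hG0adj]; tauto)
    have hG1adj : ∀ a b, G1.Adj a b ↔ G0.Adj a b ∨ (a = u ∧ b = x) ∨ (a = x ∧ b = u) := by
      intro a b
      simp only [G1, SimpleGraph.sup_adj, SimpleGraph.edge_adj]
      grind
    let G2 := G1 ⊔ SimpleGraph.edge v y
    have d2 : ∀ w, dg G2 w = dg G1 w + (if w = v then 1 else 0) + (if w = y then 1 else 0) :=
      deg_sup_edge G1 v y (Ne.symm hyv) (by rw [hG1adj, hG0adj]; grind)
    have hG2adj : ∀ a b, G2.Adj a b ↔ G1.Adj a b ∨ (a = v ∧ b = y) ∨ (a = y ∧ b = v) := by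
      intro a b
      simp only [G2, SimpleGraph.sup_adj, SimpleGraph.edge_adj]
      grind
    have d3 : ∀ w, dg G2 w = dg G w + (if w = u then 1 else 0) + (if w = v then 1 else 0) := by
      intro w
      rw [d2, d1, d0]
      omega
    refine hmax' G2 ⟨?_, ?_⟩ 1 ?_
    · intro w
      rw [d3]
      have := hd w
      by_cases h1 : w = u
      · by_cases h2 : w = v
        · have := huv (h1.symm.trans h2)
          simp [← h1] at this
          simp [← h1, ← h2]
          exact this
        · simp [h1, h2] 
          have : u ≠ v := fun h => h2 (h1.trans h)
          simp [this]; omega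
      · by_cases h2 : w = v
        · subst h2; simp [h1]; omega
        · simp [h1, h2]; omega
    · intro a ha b hb
      rw [← hGS a ha b hb, hG2adj, hG1adj, hG0adj]
      grind
    · simp only [d3, Finset.sum_add_distrib]
      simp
  · push Not at hxy
    let D : Finset V := B ∪ B.biUnion (fun x => G.neighborFinset x)
    have hD : D.card ≤ (S.card + 2 * K + 2) * (K + 1) := by
      have h1 := Finset.card_union_le B (B.biUnion (fun x => G.neighborFinset x))
      have h2 : (B.biUnion (fun x => G.neighborFinset x)).card ≤ B.card * K :=
        Finset.card_biUnion_le_card_mul _ _ _ (by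
          intro x _
          rw [G.card_neighborFinset_eq_degree, dg_eq]
          exact (hd x).trans (hK x))
      have h3 : B.card + B.card * K ≤ (S.card + 2 * K + 2) * (K + 1) := by
        calc B.card + B.card * K = B.card * (K + 1) := by ring
          _ ≤ _ := Nat.mul_le_mul_right _ hB
      exact (h1.trans (by omega)).trans h3
    have h2 : 1 < ((Finset.univ.filter (fun x => x ∉ S ∧ 1 ≤ t x)) \ D).card := by
      have := Finset.le_card_sdiff D (Finset.univ.filter (fun x => x ∉ S ∧ 1 ≤ t x))
      omega
    obtain ⟨x, hx, y, hy, hne⟩ := Finset.one_lt_card.mp h2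
    have iso : ∀ x, x ∉ D → ∀ z, ¬ G.Adj x z := by
      intro x hx z hz
      simp only [D, Finset.mem_union, Finset.mem_biUnion, SimpleGraph.mem_neighborFinset] at hx
      push Not at hx
      by_cases hzB : z ∈ B
      · exact hx.2 z hzB hz.symm
      · exact hxy x z hx.1 hzB hz
    simp only [Finset.mem_sdiff, Finset.mem_filter, Finset.mem_univ, true_and] at hx hy
    have dz : ∀ x, x ∉ D → dg G x = 0 := by
      intro x hx
      rw [dg, Set.ncard_eq_zero]
      ext z
      simp [iso x hx z]
    let G1 := G ⊔ SimpleGraph.edge x y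
    have d1 : ∀ w, dg G1 w = dg G w + (if w = x then 1 else 0) + (if w = y then 1 else 0) :=
      deg_sup_edge G x y hne (iso x hx.2 y)
    refine hmax' G1 ⟨?_, ?_⟩ 1 ?_
    · intro w
      rw [d1]
      have h3 := dz x hx.2
      have h4 := dz y hy.2
      have := hd w
      by_cases h1 : w = x
      · subst h1; simp [hne, h3]; exact hx.1.2
      · by_cases h2 : w = y
        · subst h2; simp [h1, h4]; exact hy.1.2
        · simp [h1, h2]; omega
    · intro a ha b hb
      rw [← hGS a ha b hb]
      simp only [G1, SimpleGraph.sup_adj, SimpleGraph.edge_adj]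
      grind
    · simp only [d1, Finset.sum_add_distrib]
      simp

lemma assign (c : ℕ → ℕ) (M n : ℕ) (h : ∑ k ∈ Finset.range M, c k = n) :
    ∃ t : Fin n → ℕ, (∀ x, t x < M) ∧ (∀ k < M, {x | t x = k}.ncard = c k) ∧
      ∑ x, t x = ∑ k ∈ Finset.range M, c k * k := by
  have hcard : Fintype.card (Σ k : Fin M, Fin (c k)) = Fintype.card (Fin n) := by
    simp [← h, Finset.sum_range]
  let e : (Σ k : Fin M, Fin (c k)) ≃ Fin n := Fintype.equivOfCardEq hcard
  refine ⟨fun x => (e.symm x).1, fun x => (e.symm x).1.2, ?_, ?_⟩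
  · intro k hk
    have : {x | ((e.symm x).1 : ℕ) = k} = Set.range (fun i : Fin (c k) => e ⟨⟨k, hk⟩, i⟩) := by
      ext x
      simp only [Set.mem_ofPred_eq, Set.mem_range]
      constructor
      · intro hx
        subst hx
        exact ⟨(e.symm x).2, by simp⟩
      · rintro ⟨i, rfl⟩
        simp
    rw [this, ← Set.image_univ, Set.ncard_image_of_injective _ (by
      intro i j hij
      simpa using hij)]
    simp [Set.ncard_univ]
  · rw [← Equiv.sum_comp e]
    simp only [Equiv.symm_apply_apply]
    rw [Fintype.sum_sigma]
    simp [Finset.sum_range]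

lemma core (n m : ℕ) (hm : 3 ≤ m) (c : ℕ → ℕ) (hc1 : ∀ k, m ≤ k → k < 2 * m → c k = 1)
    (hc0 : ∀ k, 2 * m ≤ k → c k = 0)
    (hsum : ∑ k ∈ Finset.range (2 * m), c k = n)
    (heven : Even (∑ k ∈ Finset.range (2 * m), c k * k))
    (hbig : (m + 2 * (2 * m) + 2) * (2 * m + 1) + 2 ≤ c 1)
    (H : SimpleGraph (Fin m)) :
    ∃ G : SimpleGraph (Fin n), (∀ k, Vcard G k = c k) ∧
          ∃ f : Fin m → Fin n, Function.Injective f ∧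
            ∀ u v : Fin m, H.Adj u v ↔ G.Adj (f u) (f v) := by
  classical
  obtain ⟨t, htM, htc, hts⟩ := assign c (2 * m) n hsum
  have hf : ∀ j : Fin m, ∃ x, t x = m + j := by
    intro j
    have h1 := htc (m + j) (by omega)
    rw [hc1 _ (by omega) (by omega)] at h1
    obtain ⟨x, hx⟩ := Set.nonempty_of_ncard_ne_zero (s := {x | t x = m + (j : ℕ)}) (by omega)
    exact ⟨x, hx⟩
  choose f hf using hf
  have finj : Function.Injective f := by
    intro i j hij
    have h1 := hf i
    rw [hij, hf j] at h1
    exact Fin.ext (by omega)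
  let S : Finset (Fin n) := Finset.univ.image f
  have hScard : S.card = m := by
    simp [S, Finset.card_image_of_injective _ finj]
  let H0 : SimpleGraph (Fin n) :=
    { Adj := fun x y => ∃ u v, H.Adj u v ∧ f u = x ∧ f v = y
      symm := ⟨by
        rintro x y ⟨u, v, h, h1, h2⟩
        exact ⟨v, u, h.symm, h2, h1⟩⟩
      loopless := ⟨by
        rintro x ⟨u, v, h, h1, h2⟩
        exact h.ne (finj (h1.trans h2.symm))⟩ }
  have hH0 : ∀ x y, H0.Adj x y ↔ ∃ u v, H.Adj u v ∧ f u = x ∧ f v = y := by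
    intro x y
    rfl
  have hHS : ∀ x y, H0.Adj x y → x ∈ S ∧ y ∈ S := by
    intro x y h
    obtain ⟨u, v, -, rfl, rfl⟩ := (hH0 x y).1 h
    simp [S]
  obtain ⟨G, hG, hGS⟩ := realize S H0 t (2 * m) hHS (by
      intro x
      by_cases hx : x ∈ S
      · have h1 : dg H0 x ≤ m := by
          rw [← hScard, dg, ← Set.ncard_coe_finset]
          exact Set.ncard_le_ncard (fun y hy => (hHS x y hy).2)
        obtain ⟨j, -, rfl⟩ := Finset.mem_image.1 hx
        rw [hf]
        omega
      · have : H0.neighborSet x = ∅ := by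
          ext y
          simp only [SimpleGraph.mem_neighborSet, Set.mem_empty_iff_false, iff_false]
          exact fun h => hx (hHS x y h).1
        simp [dg, this])
    (fun x => (htM x).le) (by rw [hts]; exact heven) (by
      rw [hScard]
      refine hbig.trans ?_
      rw [← htc 1 (by omega), ← Set.ncard_coe_finset]
      refine Set.ncard_le_ncard (fun x hx => ?_)
      simp only [Set.mem_ofPred_eq] at hx
      simp only [S, Finset.coe_filter, Finset.mem_univ, true_and, Set.mem_ofPred_eq, hx, le_refl,
        and_true, Finset.mem_image, not_exists]
      intro j hj
      have := hf j
      rw [hj, hx] at this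
      omega)
  refine ⟨G, ?_, f, finj, ?_⟩
  · intro k
    have h1 : Vcard G k = {x | t x = k}.ncard := by
      unfold Vcard
      congr 1
      ext x
      simp only [Set.mem_ofPred_eq, ← hG x]
      rfl
    rw [h1]
    by_cases hk : k < 2 * m
    · exact htc k hk
    · rw [hc0 k (by omega), Set.ncard_eq_zero]
      ext x
      have := htM x
      simp only [Set.mem_ofPred_eq, Set.mem_empty_iff_false, iff_false]
      omega
  · intro u v
    rw [hGS (f u) (by simp [S]) (f v) (by simp [S]), hH0]
    constructor
    · intro h
      exact ⟨u, v, h, rfl, rfl⟩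
    · rintro ⟨a, b, h, h1, h2⟩
      rwa [← finj h1, ← finj h2]

lemma i1_spec (α C : ℝ) (hα : 2 < α) (hC : 0 < C) (n : ℕ) :
    0 < i1 α C n ∧ C * (n : ℝ) / (i1 α C n : ℝ) ^ α < 2 ∧
      ∀ k : ℕ, 0 < k → k < i1 α C n → 2 ≤ C * (n : ℝ) / (k : ℝ) ^ α := by
  have hne : {i : ℕ | 0 < i ∧ ⌊C * (n : ℝ) / (i : ℝ) ^ α⌋ ≤ 1}.Nonempty := by
    refine ⟨⌈C * (n : ℝ)⌉₊ + 1, by omega, ?_⟩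
    have h1 : C * (n : ℝ) ≤ ((⌈C * (n : ℝ)⌉₊ + 1 : ℕ) : ℝ) := by
      push_cast
      linarith [Nat.le_ceil (C * (n : ℝ))]
    have h3 : (1 : ℝ) ≤ ((⌈C * (n : ℝ)⌉₊ + 1 : ℕ) : ℝ) := by
      push_cast
      linarith [Nat.cast_nonneg (α := ℝ) ⌈C * (n : ℝ)⌉₊]
    have h2 := Real.self_le_rpow_of_one_le h3 (by linarith : 1 ≤ α)
    have h4 : C * (n : ℝ) / ((⌈C * (n : ℝ)⌉₊ + 1 : ℕ) : ℝ) ^ α ≤ 1 := by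
      rw [div_le_one (by linarith)]
      linarith
    have : ⌊C * (n : ℝ) / ((⌈C * (n : ℝ)⌉₊ + 1 : ℕ) : ℝ) ^ α⌋ < 2 := by
      rw [Int.floor_lt]
      push_cast at h4 ⊢
      linarith
    omega
  have hmem := Nat.sInf_mem hne
  refine ⟨hmem.1, ?_, ?_⟩
  · have h1 : ⌊C * (n : ℝ) / (i1 α C n : ℝ) ^ α⌋ ≤ 1 := hmem.2
    have h2 : ⌊C * (n : ℝ) / (i1 α C n : ℝ) ^ α⌋ < 2 := by omega
    rw [Int.floor_lt] at h2
    exact_mod_cast h2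
  · intro k hk hlt
    have h1 := Nat.notMem_of_lt_sInf hlt
    simp only [Set.mem_ofPred_eq, not_and, not_le] at h1
    have h2 : (2 : ℤ) ≤ ⌊C * (n : ℝ) / (k : ℝ) ^ α⌋ := by
      have := h1 hk
      omega
    rw [Int.le_floor] at h2
    exact_mod_cast h2

lemma i1_bound (α C : ℝ) (hα : 2 < α) (hC : 0 < C) :
    ∃ N : ℕ, ∀ n : ℕ, N ≤ n → 3 ≤ i1 α C n ∧ 25 * (i1 α C n : ℝ) ^ 2 + 1 ≤ C * n := by
  have h1 := (tendsto_rpow_atTop (by linarith : 0 < α - 2)).eventually_ge_atTop 100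
  obtain ⟨Y, hY⟩ := (h1.and (Filter.eventually_ge_atTop 1)).exists_forall_of_atTop
  have h2 : Filter.Tendsto (fun n : ℕ => C * (n : ℝ)) Filter.atTop Filter.atTop :=
    tendsto_natCast_atTop_atTop.const_mul_atTop hC
  obtain ⟨N, hN⟩ := (((h2.eventually_ge_atTop (25 * (Y + 1) ^ 2 + 1)).and
    ((h2.eventually_ge_atTop (2 * 2 ^ α)).and (h2.eventually_ge_atTop 2)))).exists_forall_of_atTop
  refine ⟨N, fun n hn => ?_⟩
  obtain ⟨a1, a2, a3⟩ := hN n hn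
  obtain ⟨b1, b2, b3⟩ := i1_spec α C hα hC n
  have hm : 3 ≤ i1 α C n := by
    by_contra hlt
    have h12 : i1 α C n = 1 ∨ i1 α C n = 2 := by omega
    rcases h12 with h | h
    · rw [h] at b2
      simp at b2
      linarith
    · rw [h, div_lt_iff₀ (by positivity)] at b2
      push_cast at b2
      linarith
  refine ⟨hm, ?_⟩
  have h3 := b3 (i1 α C n - 1) (by omega) (by omega)
  obtain ⟨k, hk⟩ : ∃ k, i1 α C n = k + 1 := ⟨i1 α C n - 1, by omega⟩
  rw [hk] at h3 ⊢
  simp only [Nat.add_sub_cancel] at h3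
  have hk2 : (2 : ℝ) ≤ (k : ℝ) := by
    have : 2 ≤ k := by omega
    exact_mod_cast this
  rw [le_div_iff₀ (by positivity)] at h3
  push_cast
  by_cases hkY : Y ≤ (k : ℝ)
  · obtain ⟨c1, c2⟩ := hY k hkY
    have h5 : (k : ℝ) ^ α = (k : ℝ) ^ (α - 2) * (k : ℝ) ^ 2 := by
      rw [← Real.rpow_natCast, ← Real.rpow_add (by linarith)]
      norm_num
    have h6 : 100 * (k : ℝ) ^ 2 ≤ (k : ℝ) ^ α := by
      rw [h5]
      exact mul_le_mul_of_nonneg_right c1 (by positivity)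
    nlinarith
  · push Not at hkY
    have h7 : ((k : ℝ) + 1) ^ 2 ≤ (Y + 1) ^ 2 := by
      apply pow_le_pow_left₀ <;> linarith
    linarith

lemma sum_floor_le (α C : ℝ) (hα : 2 < α) (hC : 0 < C) (hCz : C ≤ 1 / zetaR α) (n m : ℕ) :
    ∑ k ∈ Finset.range m, ⌊C * (n : ℝ) / ((k + 1 : ℕ) : ℝ) ^ α⌋₊ ≤ n := by
  have hs : Summable (fun k : ℕ => ((k : ℝ) + 1) ^ (-α)) := by
    have := (summable_nat_add_iff 1).2 (Real.summable_nat_rpow.2 (by linarith : -α < -1))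
    simpa using this
  have hle : ∑ k ∈ Finset.range m, ((k : ℝ) + 1) ^ (-α) ≤ zetaR α :=
    hs.sum_le_tsum _ (fun k _ => by positivity)
  have hz : 0 < zetaR α := by
    by_contra h
    have : 1 / zetaR α ≤ 0 := one_div_nonpos.2 (not_lt.1 h)
    linarith
  have hCz' : C * zetaR α ≤ 1 := (le_div_iff₀ hz).1 hCz
  have : ((∑ k ∈ Finset.range m, ⌊C * (n : ℝ) / ((k + 1 : ℕ) : ℝ) ^ α⌋₊ : ℕ) : ℝ) ≤ n := by
    push_cast
    calc _ ≤ ∑ k ∈ Finset.range m, C * (n : ℝ) * ((k : ℝ) + 1) ^ (-α) := by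
          apply Finset.sum_le_sum
          intro k _
          refine (Nat.floor_le (by positivity)).trans (le_of_eq ?_)
          rw [Real.rpow_neg (by positivity)]
          rfl
      _ = (n : ℝ) * (C * ∑ k ∈ Finset.range m, ((k : ℝ) + 1) ^ (-α)) := by
          rw [← Finset.mul_sum]; ring
      _ ≤ (n : ℝ) * (C * zetaR α) := by gcongr
      _ ≤ (n : ℝ) * 1 := by gcongr
      _ = n := by ring
  exact_mod_cast this

/-- The target number of vertices of each degree, with `e` fewer leaves for parity. -/
noncomputable def cnt (F : ℕ → ℕ) (m z e k : ℕ) : ℕ :=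
  if k = 0 then z else if k = 1 then F 1 - m - e else if k < m then F k else
    if k < 2 * m then 1 else 0

lemma sum_cnt (F : ℕ → ℕ) (m : ℕ) (hm : 3 ≤ m) (z e : ℕ) (w : ℕ → ℕ) :
    ∑ k ∈ Finset.range (2 * m), cnt F m z e k * w k =
      z * w 0 + (F 1 - m - e) * w 1 + ∑ k ∈ Finset.Ico 2 m, F k * w k +
        ∑ k ∈ Finset.Ico m (2 * m), w k := by
  rw [Finset.range_eq_Ico, ← Finset.sum_Ico_consecutive _ (by omega : 0 ≤ 2) (by omega : 2 ≤ 2 * m),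
    ← Finset.sum_Ico_consecutive _ (by omega : 2 ≤ m) (by omega : m ≤ 2 * m), ← add_assoc]
  congr 1
  · congr 1
    apply Finset.sum_congr rfl
    intro k hk
    rw [Finset.mem_Ico] at hk
    simp [cnt, show k ≠ 0 by omega, show k ≠ 1 by omega, hk.2]
  · apply Finset.sum_congr rfl
    intro k hk
    rw [Finset.mem_Ico] at hk
    simp [cnt, show k ≠ 0 by omega, show k ≠ 1 by omega, hk.2, show ¬ k < m by omega]

theorem stmt9 (α C : ℝ) (hα : 2 < α) (hC : 0 < C) (hCz : C ≤ 1 / zetaR α) :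
    ∃ N : ℕ, ∀ n : ℕ, N ≤ n →
      ∀ H : SimpleGraph (Fin (i1 α C n)),
        ∃ G : SimpleGraph (Fin n), IsProperPowerLaw α C G ∧
          ∃ f : Fin (i1 α C n) → Fin n, Function.Injective f ∧
            ∀ u v : Fin (i1 α C n), H.Adj u v ↔ G.Adj (f u) (f v) := by
  obtain ⟨N, hN⟩ := i1_bound α C hα hC
  refine ⟨N, fun n hn H => ?_⟩
  obtain ⟨hm, hbig⟩ := hN n hn
  obtain ⟨-, hlt2, hge2⟩ := i1_spec α C hα hC n
  have hdef : i1 α C n = i1 α C n := rfl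
  unfold IsProperPowerLaw
  generalize i1 α C n = m at *
  clear hdef
  have hCn : 0 ≤ C * (n : ℝ) := by positivity
  obtain ⟨F, hF⟩ : ∃ F : ℕ → ℕ, ∀ k, F k = ⌊C * (n : ℝ) / (k : ℝ) ^ α⌋₊ := ⟨_, fun _ => rfl⟩
  have hFi : ∀ k, (F k : ℤ) = ⌊C * (n : ℝ) / (k : ℝ) ^ α⌋ := by
    intro k
    rw [hF]
    exact Int.natCast_floor_eq_floor (by positivity)
  have hF1 : (F 1 : ℤ) = ⌊C * (n : ℝ)⌋ := by
    rw [hFi]; simp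
  have hFbig : 25 * m ^ 2 + 1 ≤ F 1 := by
    rw [hF]
    apply Nat.le_floor
    push_cast
    simpa using hbig
  have hFm : ∀ k, 0 < k → k < m → 2 ≤ F k := by
    intro k h0 h1
    rw [hF]
    exact Nat.le_floor (by exact_mod_cast hge2 k h0 h1)
  have hanti : ∀ k, 0 < k → F (k + 1) ≤ F k := by
    intro k hk
    rw [hF, hF]
    apply Nat.floor_le_floor
    have : (0 : ℝ) < k := by exact_mod_cast hk
    apply div_le_div_of_nonneg_left hCn (by positivity)
    apply Real.rpow_le_rpow (by positivity) (by push_cast; linarith) (by linarith)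
  have hmpos : (0 : ℝ) < m := by
    have : 0 < m := by omega
    exact_mod_cast this
  have hnpos : 0 < C * (n : ℝ) := by
    have : 0 ≤ 25 * (m : ℝ) ^ 2 := by positivity
    linarith
  have hmid : ∀ k, m ≤ k → C * (n : ℝ) / (k : ℝ) ^ α < 2 := by
    intro k hk
    refine lt_of_le_of_lt ?_ hlt2
    have : (m : ℝ) ≤ k := by exact_mod_cast hk
    apply div_le_div_of_nonneg_left hCn (by positivity)
    exact Real.rpow_le_rpow (by positivity) this (by linarith)
  have hhigh : ∀ k, 2 * m ≤ k → C * (n : ℝ) / (k : ℝ) ^ α < 1 := by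
    intro k hk
    have h1 : 2 * (m : ℝ) ≤ k := by exact_mod_cast hk
    have h2 : (2 * (m : ℝ)) ^ α ≤ (k : ℝ) ^ α := Real.rpow_le_rpow (by positivity) h1 (by linarith)
    rw [Real.mul_rpow (by norm_num) hmpos.le] at h2
    have h3 : (2 : ℝ) ≤ 2 ^ α := Real.self_le_rpow_of_one_le (by norm_num) (by linarith)
    rw [div_lt_iff₀ (by positivity)] at hlt2
    have h4 : 0 < (m : ℝ) ^ α := by positivity
    rw [div_lt_one (by nlinarith)]
    nlinarith
  have hsumF : F 1 + ∑ k ∈ Finset.Ico 2 m, F k ≤ n := by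
    have h := sum_floor_le α C hα hC hCz n (m - 1)
    simp only [← hF] at h
    rw [Finset.range_eq_Ico, Finset.sum_Ico_add' (fun k => F k) 0 (m - 1) 1,
      show m - 1 + 1 = m by omega, Finset.sum_eq_sum_Ico_succ_bot (by omega)] at h
    exact h
  have hmm : m ≤ m ^ 2 := by nlinarith
  -- parity
  obtain ⟨e, he1, hpar⟩ : ∃ e, e ≤ 1 ∧ Even ((F 1 - m - e) + ∑ k ∈ Finset.Ico 2 m, F k * k +
        ∑ k ∈ Finset.Ico m (2 * m), k) := by
    rcases Nat.even_or_odd ((F 1 - m) + ∑ k ∈ Finset.Ico 2 m, F k * k +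
        ∑ k ∈ Finset.Ico m (2 * m), k) with h | ⟨r, hr⟩
    · exact ⟨0, by omega, h⟩
    · exact ⟨1, by omega, ⟨r, by omega⟩⟩
  let z := n - ((F 1 - m - e) + ∑ k ∈ Finset.Ico 2 m, F k + m)
  have hz : z + (F 1 - m - e) + ∑ k ∈ Finset.Ico 2 m, F k + m = n := by
    simp only [z]
    omega
  obtain ⟨G, hV, hf⟩ := core n m hm (cnt F m z e)
    (by intro k h1 h2
        simp [cnt, show k ≠ 0 by omega, show k ≠ 1 by omega, h2, show ¬ k < m by omega])
    (by intro k h2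
        simp [cnt, show k ≠ 0 by omega, show k ≠ 1 by omega, show ¬ k < 2 * m by omega,
          show ¬ k < m by omega])
    (by have := sum_cnt F m hm z e (fun _ => 1)
        simp only [mul_one, Finset.sum_const, Nat.card_Ico, smul_eq_mul] at this
        rw [this]
        omega)
    (by have := sum_cnt F m hm z e (fun k => k)
        simp only [mul_one, mul_zero, zero_add] at this
        rw [this]
        exact hpar)
    (by simp only [cnt, one_ne_zero, if_false, if_true]
        have : (m + 2 * (2 * m) + 2) * (2 * m + 1) + 2 = 10 * m ^ 2 + 9 * m + 4 := by ring
        have : 3 * m ≤ m ^ 2 := by nlinarith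
        omega) H
  refine ⟨G, ⟨⟨?_, ?_⟩, ⟨?_, ?_⟩, ?_, ?_⟩, hf⟩
  · rw [hV, ← hF1]
    simp only [cnt, one_ne_zero, if_false, if_true]
    omega
  · rw [hV]
    have := Int.floor_le_ceil (C * (n : ℝ))
    rw [← hF1] at this
    simp only [cnt, one_ne_zero, if_false, if_true]
    omega
  · have := hFi 2
    push_cast at this
    rw [hV, ← this]
    simp [cnt, show 2 < m by omega]
  · have := hFi 2
    have h2 := Int.floor_le_ceil (C * (n : ℝ) / (2 : ℝ) ^ α)
    push_cast at this
    rw [← this] at h2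
    rw [hV]
    simp [cnt, show 2 < m by omega]
    omega
  · intro i h3 _
    rw [hV]
    have hipos : (0 : ℝ) < i := by
      have : 0 < i := by omega
      exact_mod_cast this
    have hpos : 0 < C * (n : ℝ) / (i : ℝ) ^ α := by positivity
    simp only [cnt, show i ≠ 0 by omega, show i ≠ 1 by omega, if_false]
    split_ifs with h1 h2
    · left
      exact hFi i
    · have := hmid i (by omega)
      by_cases hc : C * (n : ℝ) / (i : ℝ) ^ α ≤ 1
      · right
        symm
        rw [Int.ceil_eq_iff]
        push_cast
        constructor <;> linarith
      · left
        symm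
        rw [Int.floor_eq_iff]
        push_cast
        constructor <;> linarith
    · left
      symm
      rw [Int.floor_eq_iff]
      have := hhigh i (by omega)
      push_cast
      constructor <;> linarith
  · intro i h2 _
    rw [hV, hV]
    have h4 := hanti i (by omega)
    have h5 := hFm i (by omega)
    simp only [cnt, show i ≠ 0 by omega, show i ≠ 1 by omega, if_false,
      show i + 1 ≠ 0 by omega, show i + 1 ≠ 1 by omega]
    split_ifs <;> omega
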